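/- arXiv:2206.06271 — 5 statements merged into one kernel-verified Lean document; each statement's English description precedes it below -/
import Mathlib

section
/- Let E be an n-dimensional real normed vector space (n ≥ 1) and φ ∈ Φ. Then dim_φ(E) = dim_φ{0} = limsup_{ε→0⁺} φ₁(ε^{-n})/φ₂(ε^{-1}). -/
open Filter Topology Set Pointwise
open scoped ENNReal ENat Classical

noncomputable section

/-- A scale function, a member of one component of the family `Φ`:
a nondecreasing positive function on `(0,∞)` tending to `∞` at `∞`
with `φ(2t)/φ(t) → 1`. -/
structure IsScale (φ : ℝ → ℝ) : Prop where
  mono : ∀ ⦃s t : ℝ⦄, 0 < s → s ≤ t → φ s ≤ φ t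
  pos : ∀ ⦃t : ℝ⦄, 0 < t → 0 < φ t
  tendsto_atTop : Tendsto φ atTop atTop
  tendsto_ratio : Tendsto (fun t : ℝ => φ (2 * t) / φ t) atTop (𝓝 1)

variable {E : Type*} [AddCommGroup E] [Module ℝ E] [TopologicalSpace E]

/-- The ε-number `N(ε, V, U)`: the least `n` for which there are `v₁, …, vₙ ∈ V`
with `V ⊆ ⋃ᵢ (vᵢ + ε • U)`; `∞` if no finite such cover exists. -/
def epsNum (ε : ℝ) (V U : Set E) : ℕ∞ :=
  sInf {n : ℕ∞ | ∃ s : Finset E, (↑s : Set E) ⊆ V ∧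
    (V ⊆ ⋃ v ∈ s, v +ᵥ ε • U) ∧ (s.card : ℕ∞) = n}

/-- Apply a scale function to an extended natural number, with `φ(∞) = ∞`,
landing in `[0,∞]`. -/
def phiApp (φ : ℝ → ℝ) (n : ℕ∞) : ℝ≥0∞ :=
  if n = ⊤ then ⊤ else ENNReal.ofReal (φ n.toNat)

/-- The relative point-extended box dimension `dim_φ{x}_A`. -/
def pointDim (φ₁ φ₂ : ℝ → ℝ) (x : E) (A : Set E) : ℝ≥0∞ :=
  if x ∈ closure A then
    ⨆ U ∈ 𝓝 (0 : E), ⨅ V ∈ 𝓝 x,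
      limsup (fun ε : ℝ =>
          phiApp φ₁ (epsNum ε (V ∩ A) U) / ENNReal.ofReal (φ₂ (1 / ε)))
        (𝓝[>] (0 : ℝ))
  else 0

/-- The point-extended box dimension of a set, `dim_φ(A)`. -/
def setDim (φ₁ φ₂ : ℝ → ℝ) (A : Set E) : ℝ≥0∞ :=
  ⨆ x ∈ closure A, pointDim φ₁ φ₂ x A


section ScaleFunctions

variable {φ : ℝ → ℝ}

lemma IsScale.tendsto_ratio_two_pow (h : IsScale φ) (k : ℕ) :
    Tendsto (fun t : ℝ => φ (2 ^ k * t) / φ t) atTop (𝓝 1) := by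
  induction k with
  | zero =>
    refine tendsto_const_nhds.congr' ?_
    filter_upwards [eventually_gt_atTop (0 : ℝ)] with t ht
    simp [(h.pos ht).ne']
  | succ k ih =>
    have hlim : Tendsto (fun t : ℝ => (2 : ℝ) ^ k * t) atTop atTop :=
      tendsto_id.const_mul_atTop (by positivity)
    have hmul := (h.tendsto_ratio.comp hlim).mul ih
    rw [one_mul] at hmul
    refine hmul.congr' ?_
    filter_upwards [eventually_gt_atTop (0 : ℝ)] with t ht
    have hpos := h.pos (show 0 < (2 : ℝ) ^ k * t by positivity)
    simp only [Function.comp_apply]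
    rw [div_mul_div_cancel₀ hpos.ne', pow_succ', mul_assoc]

/-- A scale function varies slowly: rescaling its argument costs at most a factor `a > 1`. -/
lemma IsScale.eventually_const_mul_le (h : IsScale φ) {C a : ℝ} (hC : 0 < C) (ha : 1 < a) :
    ∀ᶠ t in atTop, φ (C * t) ≤ a * φ t := by
  obtain ⟨k, hk⟩ := pow_unbounded_of_one_lt C (one_lt_two : (1 : ℝ) < 2)
  filter_upwards [(h.tendsto_ratio_two_pow k).eventually_le_const ha,
    eventually_gt_atTop (0 : ℝ)] with t hle ht
  rw [div_le_iff₀ (h.pos ht)] at hle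
  exact (h.mono (by positivity) (by gcongr)).trans hle

end ScaleFunctions

lemma limsup_le_limsup_of_forall_one_lt {α : Type*} {l : Filter α} {f g : α → ℝ≥0∞}
    (h : ∀ a : ℝ, 1 < a → ∀ᶠ x in l, f x ≤ ENNReal.ofReal a * g x) :
    limsup f l ≤ limsup g l := by
  have hle : ∀ a : ℝ, 1 < a → limsup f l ≤ ENNReal.ofReal a * limsup g l := fun a ha =>
    (limsup_le_limsup (h a ha)).trans_eq (ENNReal.limsup_const_mul_of_ne_top ENNReal.ofReal_ne_top)
  rcases eq_or_ne (limsup g l) ⊤ with htop | htop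
  · simp [htop]
  have hlim : Tendsto (fun a : ℝ => ENNReal.ofReal a * limsup g l) (𝓝[>] 1)
      (𝓝 (limsup g l)) := by
    have := ENNReal.Tendsto.mul_const (b := limsup g l)
      ((ENNReal.continuous_ofReal.tendsto 1).mono_left (nhdsWithin_le_nhds (s := Ioi 1)))
      (Or.inr htop)
    simpa using this
  exact ge_of_tendsto hlim (eventually_mem_nhdsWithin.mono hle)

section EpsNum

variable {F : Type*} [AddCommGroup F] [Module ℝ F] {φ : ℝ → ℝ} {ε c : ℝ} {V U : Set F}

lemma phiApp_epsNum_le (h : IsScale φ) (hV : V.Nonempty) {s : Finset F}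
    (hsV : (s : Set F) ⊆ V) (hs : V ⊆ ⋃ v ∈ s, v +ᵥ ε • U) (hc : (s.card : ℝ) ≤ c) :
    phiApp φ (epsNum ε V U) ≤ ENNReal.ofReal (φ c) := by
  have hne : {n : ℕ∞ | ∃ s : Finset F, (↑s : Set F) ⊆ V ∧
      (V ⊆ ⋃ v ∈ s, v +ᵥ ε • U) ∧ (s.card : ℕ∞) = n}.Nonempty := ⟨_, s, hsV, hs, rfl⟩
  obtain ⟨t, -, ht, htn⟩ := csInf_mem hne
  have hle : epsNum ε V U ≤ s.card := csInf_le' ⟨s, hsV, hs, rfl⟩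
  change (t.card : ℕ∞) = epsNum ε V U at htn
  rw [← htn] at hle ⊢
  have hts : t.card ≤ s.card := by exact_mod_cast hle
  have htpos : 0 < t.card := by
    rw [Finset.card_pos, Finset.nonempty_iff_ne_empty]
    rintro rfl
    obtain ⟨x, hx⟩ := hV
    simpa using ht hx
  simp only [phiApp, ENat.natCast_ne_top, if_false, ENat.toNat_natCast]
  exact ENNReal.ofReal_le_ofReal
    (h.mono (by exact_mod_cast htpos) (le_trans (by exact_mod_cast hts) hc))

lemma le_phiApp_epsNum (h : IsScale φ) (hc : 0 < c)
    (hcard : ∀ s : Finset F, (V ⊆ ⋃ v ∈ s, v +ᵥ ε • U) → c ≤ s.card) :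
    ENNReal.ofReal (φ c) ≤ phiApp φ (epsNum ε V U) := by
  by_cases htop : epsNum ε V U = ⊤
  · simp [phiApp, htop]
  have hne : {n : ℕ∞ | ∃ s : Finset F, (↑s : Set F) ⊆ V ∧
      (V ⊆ ⋃ v ∈ s, v +ᵥ ε • U) ∧ (s.card : ℕ∞) = n}.Nonempty := by
    by_contra hempty
    rw [not_nonempty_iff_eq_empty] at hempty
    exact htop (by rw [epsNum, hempty, sInf_empty])
  obtain ⟨t, -, ht, htn⟩ := csInf_mem hne
  change (t.card : ℕ∞) = epsNum ε V U at htn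
  rw [← htn]
  simp only [phiApp, ENat.natCast_ne_top, if_false, ENat.toNat_natCast]
  exact ENNReal.ofReal_le_ofReal (h.mono hc (hcard t ht))

end EpsNum

section Volume

variable {F : Type*} [NormedAddCommGroup F] [NormedSpace ℝ F]

lemma vadd_smul_ball_zero {ε : ℝ} (hε : 0 < ε) (v : F) (r : ℝ) :
    v +ᵥ ε • Metric.ball (0 : F) r = Metric.ball v (ε * r) := by
  rw [smul_ball hε.ne', smul_zero, Metric.vadd_ball, vadd_eq_add, add_zero, Real.norm_of_nonneg hε.le]

variable [FiniteDimensional ℝ F]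

open MeasureTheory Module

lemma card_mul_pow_le_of_pairwiseDisjoint_ball {s : Finset F} {x : F} {δ ρ : ℝ} (hδ : 0 < δ)
    (hρ : 0 < ρ) (hdisj : (s : Set F).PairwiseDisjoint fun v => Metric.ball v δ)
    (hsub : ∀ v ∈ s, Metric.ball v δ ⊆ Metric.ball x ρ) :
    (s.card : ℝ) * δ ^ finrank ℝ F ≤ ρ ^ finrank ℝ F := by
  borelize F
  let μ : Measure F := Measure.addHaar
  have hμ : (s.card : ℝ≥0∞) * ENNReal.ofReal (δ ^ finrank ℝ F) * μ (Metric.ball 0 1) ≤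
      ENNReal.ofReal (ρ ^ finrank ℝ F) * μ (Metric.ball 0 1) := by
    calc _ = μ (⋃ v ∈ s, Metric.ball v δ) := by
          rw [measure_biUnion_finset hdisj fun _ _ => measurableSet_ball]
          simp only [μ.addHaar_ball_of_pos _ hδ, Finset.sum_const, nsmul_eq_mul, mul_assoc]
      _ ≤ μ (Metric.ball x ρ) := measure_mono (iUnion₂_subset hsub)
      _ = _ := μ.addHaar_ball_of_pos _ hρ
  rw [ENNReal.mul_le_mul_iff_left (Metric.measure_ball_pos _ _ zero_lt_one).ne'
    measure_ball_lt_top.ne] at hμ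
  simpa [hδ.le] using ENNReal.toReal_le_of_le_ofReal (by positivity) hμ

lemma pow_le_card_mul_pow_of_ball_subset {s : Finset F} {x : F} {δ ρ : ℝ} (hδ : 0 < δ)
    (hρ : 0 < ρ) (hsub : Metric.ball x ρ ⊆ ⋃ v ∈ s, Metric.ball v δ) :
    ρ ^ finrank ℝ F ≤ (s.card : ℝ) * δ ^ finrank ℝ F := by
  borelize F
  let μ : Measure F := Measure.addHaar
  have hμ : ENNReal.ofReal (ρ ^ finrank ℝ F) * μ (Metric.ball 0 1) ≤
      (s.card : ℝ≥0∞) * ENNReal.ofReal (δ ^ finrank ℝ F) * μ (Metric.ball 0 1) := by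
    calc _ = μ (Metric.ball x ρ) := (μ.addHaar_ball_of_pos _ hρ).symm
      _ ≤ μ (⋃ v ∈ s, Metric.ball v δ) := measure_mono hsub
      _ ≤ ∑ v ∈ s, μ (Metric.ball v δ) := measure_biUnion_finset_le _ _
      _ = _ := by
          simp only [μ.addHaar_ball_of_pos _ hδ, Finset.sum_const, nsmul_eq_mul, mul_assoc]
  rw [ENNReal.mul_le_mul_iff_left (Metric.measure_ball_pos _ _ zero_lt_one).ne'
    measure_ball_lt_top.ne, ← ENNReal.ofReal_natCast,
    ← ENNReal.ofReal_mul (Nat.cast_nonneg _)] at hμ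
  exact (ENNReal.ofReal_le_ofReal_iff (by positivity)).1 hμ

/-- The unit ball has a cover by balls of radius `δ` centred in it, of the cardinality predicted
by comparing volumes. -/
lemma exists_finset_cover_ball (x : F) {δ : ℝ} (hδ : 0 < δ) :
    ∃ s : Finset F, (s : Set F) ⊆ Metric.ball x 1 ∧
      (Metric.ball x 1 ⊆ ⋃ v ∈ s, Metric.ball v δ) ∧
      (s.card : ℝ) ≤ ((2 + δ) / δ) ^ finrank ℝ F := by
  let S : Set ℕ := {k | ∃ s : Finset F, (s : Set F) ⊆ Metric.ball x 1 ∧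
    ((s : Set F).Pairwise fun v w => δ ≤ dist v w) ∧ s.card = k}
  have hbound : ∀ s : Finset F, (s : Set F) ⊆ Metric.ball x 1 →
      ((s : Set F).Pairwise fun v w => δ ≤ dist v w) →
      (s.card : ℝ) ≤ ((2 + δ) / δ) ^ finrank ℝ F := by
    intro s hsx hsep
    have hcard := card_mul_pow_le_of_pairwiseDisjoint_ball (s := s) (x := x) (half_pos hδ)
      (show 0 < 1 + δ / 2 by positivity)
      (fun v hv w hw hvw => Metric.ball_disjoint_ball (by
        rw [add_halves]; exact hsep hv hw hvw))
      (fun v hv => Metric.ball_subset_ball' (by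
        have := Metric.mem_ball.1 (hsx hv); linarith))
    rw [← le_div_iff₀ (by positivity), ← div_pow] at hcard
    have hratio : (1 + δ / 2) / (δ / 2) = (2 + δ) / δ := by field_simp
    rwa [hratio] at hcard
  have hne : S.Nonempty := ⟨0, ∅, by simp⟩
  have hbdd : BddAbove S := by
    refine ⟨⌊((2 + δ) / δ) ^ finrank ℝ F⌋₊, ?_⟩
    rintro _ ⟨s, hsx, hsep, rfl⟩
    exact Nat.le_floor (hbound s hsx hsep)
  obtain ⟨s, hsx, hsep, hs⟩ := Nat.sSup_mem hne hbdd
  refine ⟨s, hsx, fun y hy => ?_, hbound s hsx hsep⟩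
  by_contra hcov
  simp only [mem_iUnion, Metric.mem_ball, not_exists, not_lt] at hcov
  have hys : y ∉ s := fun hmem => by
    have := hcov y hmem
    rw [dist_self] at this
    exact hδ.not_ge this
  have hmem : s.card + 1 ∈ S := by
    refine ⟨insert y s, ?_, ?_, Finset.card_insert_of_notMem hys⟩
    · rw [Finset.coe_insert]
      exact insert_subset hy hsx
    · rw [Finset.coe_insert]
      exact hsep.insert fun v hv _ => ⟨hcov v hv, by rw [dist_comm]; exact hcov v hv⟩
  have := le_csSup hbdd hmem
  omega

end Volume

lemma tendsto_one_div_pow_nhdsGT_zero {n : ℕ} (hn : n ≠ 0) :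
    Tendsto (fun ε : ℝ => (1 / ε) ^ n) (𝓝[>] 0) atTop := by
  simp only [one_div]
  exact (tendsto_pow_atTop hn).comp tendsto_inv_nhdsGT_zero

lemma pointDim_univ_eq_limsup {F : Type*} [NormedAddCommGroup F] [NormedSpace ℝ F]
    {n : ℕ} (hn : n ≠ 0) (hdim : Module.finrank ℝ F = n)
    {φ₁ : ℝ → ℝ} (φ₂ : ℝ → ℝ) (h₁ : IsScale φ₁) (x : F) :
    pointDim φ₁ φ₂ x univ =
      limsup (fun ε : ℝ =>
          ENNReal.ofReal (φ₁ ((1 / ε) ^ n)) / ENNReal.ofReal (φ₂ (1 / ε)))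
        (𝓝[>] (0 : ℝ)) := by
  have : FiniteDimensional ℝ F :=
    Module.finite_of_finrank_pos (by omega)
  have htend := tendsto_one_div_pow_nhdsGT_zero hn
  rw [pointDim, if_pos (by simp)]
  simp only [inter_univ]
  apply le_antisymm
  · refine iSup₂_le fun U hU => ?_
    obtain ⟨r, hr, hrU⟩ := Metric.mem_nhds_iff.1 hU
    refine (iInf₂_le (Metric.ball x 1) (Metric.ball_mem_nhds x one_pos)).trans ?_
    refine limsup_le_limsup_of_forall_one_lt fun a ha => ?_
    have hC : 0 < ((2 + r) / r) ^ n := by positivity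
    filter_upwards [htend.eventually (h₁.eventually_const_mul_le hC ha),
      Ioo_mem_nhdsGT (zero_lt_one' ℝ)] with ε hle ⟨hε, hε1⟩
    rw [← mul_div_assoc, ← ENNReal.ofReal_mul (by linarith)]
    gcongr
    refine le_trans ?_ (ENNReal.ofReal_le_ofReal hle)
    obtain ⟨s, hsx, hcov, hcard⟩ := exists_finset_cover_ball x (mul_pos hε hr)
    refine phiApp_epsNum_le h₁ ⟨x, Metric.mem_ball_self one_pos⟩ hsx ?_ (hcard.trans ?_)
    · refine hcov.trans (iUnion₂_mono fun v _ => ?_)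
      rw [← vadd_smul_ball_zero hε]
      exact vadd_set_mono (smul_set_mono hrU)
    · rw [hdim, ← mul_pow]
      gcongr
      rw [div_mul_div_comm, mul_one, mul_comm r ε]
      gcongr
      nlinarith
  · refine le_trans ?_ (le_iSup₂ (Metric.ball (0 : F) 1) (Metric.ball_mem_nhds 0 one_pos))
    refine le_iInf₂ fun V hV => ?_
    obtain ⟨r, hr, hrV⟩ := Metric.mem_nhds_iff.1 hV
    refine limsup_le_limsup_of_forall_one_lt fun a ha => ?_
    have hC : 0 < (1 / r) ^ n := by positivity
    have htend' : Tendsto (fun ε : ℝ => r ^ n * (1 / ε) ^ n) (𝓝[>] 0) atTop :=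
      htend.const_mul_atTop (by positivity)
    filter_upwards [htend'.eventually (h₁.eventually_const_mul_le hC ha),
      self_mem_nhdsWithin] with ε hle (hε : 0 < ε)
    rw [← mul_assoc, ← mul_pow, one_div_mul_cancel hr.ne', one_pow, one_mul] at hle
    rw [← mul_div_assoc]
    gcongr
    refine (ENNReal.ofReal_le_ofReal hle).trans ?_
    rw [ENNReal.ofReal_mul (by linarith)]
    gcongr
    refine le_phiApp_epsNum h₁ (by positivity) fun s hs => ?_
    simp only [vadd_smul_ball_zero hε, mul_one] at hs
    have hpow := pow_le_card_mul_pow_of_ball_subset hε hr (hrV.trans hs)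
    rw [hdim, ← div_le_iff₀ (by positivity)] at hpow
    rwa [one_div, inv_pow, ← div_eq_mul_inv]

/-- for an `n`-dimensional real normed vector space `E` (`n ≥ 1`)
and `φ ∈ Φ`, `dim_φ(E) = dim_φ{0} = limsup_{ε→0⁺} φ₁(ε^{-n})/φ₂(ε^{-1})`. -/
theorem setDim_finiteDimensional
    {E : Type*} [NormedAddCommGroup E] [NormedSpace ℝ E]
    (n : ℕ) (hn : 1 ≤ n) (hdim : Module.finrank ℝ E = n)
    (φ₁ φ₂ : ℝ → ℝ) (h₁ : IsScale φ₁) (h₂ : IsScale φ₂) :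
    setDim φ₁ φ₂ (Set.univ : Set E) = pointDim φ₁ φ₂ (0 : E) Set.univ ∧
      pointDim φ₁ φ₂ (0 : E) Set.univ =
        limsup (fun ε : ℝ =>
            ENNReal.ofReal (φ₁ ((1 / ε) ^ n)) / ENNReal.ofReal (φ₂ (1 / ε)))
          (𝓝[>] (0 : ℝ)) := by
  have hpt := pointDim_univ_eq_limsup (Nat.one_le_iff_ne_zero.1 hn) hdim φ₂ h₁ (F := E)
  refine ⟨?_, hpt 0⟩
  rw [setDim]
  simp only [hpt, closure_univ, mem_univ, iSup_pos, iSup_const]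

end
end

section
/- Let E be an n-dimensional real normed vector space (n ≥ 1), B its closed unit ball, and for ε > 0 let N(ε) be the least number of translates x + ε•B with centers x ∈ B needed to cover B. Then lim_{ε→0⁺} ln N(ε) / ln(1/ε) = n, and lim_{ε→0⁺} ln(ln N(ε)) / ln(ln(1/ε)) = 1. In particular, the point-extended box dimension of E for φ = (ln, ln) equals its algebraic dimension n, and for φ = (ln∘ln, ln∘ln) it equals 1. -/
open Filter Topology Set Pointwise
open scoped ENNReal

noncomputable section

/-- The least number of translates `x + ε • B` with centers `x ∈ B` needed to cover the
closed unit ball `B` of a real normed vector space `E`. -/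
def covT (E : Type*) [NormedAddCommGroup E] [NormedSpace ℝ E] (ε : ℝ) : ℕ :=
  sInf {m : ℕ | ∃ s : Finset E,
    (↑s : Set E) ⊆ Metric.closedBall 0 1 ∧
    (Metric.closedBall (0 : E) 1 ⊆ ⋃ x ∈ s, x +ᵥ ε • Metric.closedBall (0 : E) 1) ∧
    s.card = m}

theorem vadd_smul_unitClosedBall {E : Type*} [NormedAddCommGroup E] [NormedSpace ℝ E]
    (x : E) {ε : ℝ} (hε : 0 < ε) :
    x +ᵥ ε • Metric.closedBall (0 : E) 1 = Metric.closedBall x ε := by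
  simp [smul_unitClosedBall, abs_of_pos hε]

/-- Volume bound for covers of the unit ball by balls of radius `ε`. -/
theorem inv_pow_finrank_le_card_of_cover {E : Type*} [NormedAddCommGroup E] [NormedSpace ℝ E]
    [FiniteDimensional ℝ E] {ε : ℝ} (hε : 0 < ε) (s : Finset E)
    (hs : Metric.closedBall (0 : E) 1 ⊆ ⋃ x ∈ s, Metric.closedBall x ε) :
    (1 / ε) ^ Module.finrank ℝ E ≤ (s.card : ℝ) := by
  borelize E
  let μ : MeasureTheory.Measure E := MeasureTheory.Measure.addHaar
  have hμ : μ (Metric.closedBall (0 : E) 1) ≤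
      s.card * ENNReal.ofReal (ε ^ Module.finrank ℝ E) * μ (Metric.closedBall (0 : E) 1) := by
    calc μ (Metric.closedBall (0 : E) 1)
        ≤ μ (⋃ x ∈ s, Metric.closedBall x ε) := MeasureTheory.measure_mono hs
      _ ≤ ∑ x ∈ s, μ (Metric.closedBall x ε) := MeasureTheory.measure_biUnion_finset_le _ _
      _ = _ := by
        simp_rw [μ.addHaar_closedBall' _ hε.le]
        rw [Finset.sum_const, nsmul_eq_mul, mul_assoc]
  have h0 : μ (Metric.closedBall (0 : E) 1) ≠ 0 :=
    (Metric.measure_closedBall_pos μ _ one_pos).ne'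
  have htop : μ (Metric.closedBall (0 : E) 1) ≠ ∞ := MeasureTheory.measure_closedBall_lt_top.ne
  have h1 : (1 : ℝ≥0∞) ≤ s.card * ENNReal.ofReal (ε ^ Module.finrank ℝ E) := by
    rwa [← ENNReal.mul_le_mul_iff_left h0 htop, one_mul]
  have h2 : (1 : ℝ) ≤ s.card * ε ^ Module.finrank ℝ E := by
    rw [← ENNReal.ofReal_natCast, ← ENNReal.ofReal_mul (by positivity)] at h1
    exact ENNReal.one_le_ofReal.1 h1
  rw [one_div, inv_pow, inv_le_iff_one_le_mul₀ (by positivity)]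
  exact h2

/-- Volume bound for `ε`-separated subsets of the unit ball. -/
theorem card_le_of_separated_unitClosedBall {E : Type*} [NormedAddCommGroup E] [NormedSpace ℝ E]
    [FiniteDimensional ℝ E] {ε : ℝ} (hε : 0 < ε) (hε1 : ε ≤ 1) (s : Finset E)
    (hs : (s : Set E) ⊆ Metric.closedBall 0 1)
    (hsep : (s : Set E).Pairwise fun x y => ε ≤ dist x y) :
    (s.card : ℝ) ≤ (3 / ε) ^ Module.finrank ℝ E := by
  borelize E
  let μ : MeasureTheory.Measure E := MeasureTheory.Measure.addHaar
  have hd : (s : Set E).PairwiseDisjoint fun x => Metric.ball x (ε / 2) := fun x hx y hy hxy =>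
    Metric.ball_disjoint_ball (by linarith [hsep hx hy hxy])
  have hsub : (⋃ x ∈ s, Metric.ball x (ε / 2)) ⊆ Metric.ball (0 : E) (3 / 2) := by
    refine iUnion₂_subset fun x hx => Metric.ball_subset_ball' ?_
    have := Metric.mem_closedBall.1 (hs hx)
    linarith
  have hμ : s.card * ENNReal.ofReal ((ε / 2) ^ Module.finrank ℝ E) * μ (Metric.ball (0 : E) 1) ≤
      ENNReal.ofReal ((3 / 2) ^ Module.finrank ℝ E) * μ (Metric.ball (0 : E) 1) := by
    calc _ = ∑ x ∈ s, μ (Metric.ball x (ε / 2)) := by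
          simp_rw [μ.addHaar_ball_of_pos _ (half_pos hε)]
          rw [Finset.sum_const, nsmul_eq_mul, mul_assoc]
      _ = μ (⋃ x ∈ s, Metric.ball x (ε / 2)) :=
          (MeasureTheory.measure_biUnion_finset hd fun _ _ => measurableSet_ball).symm
      _ ≤ μ (Metric.ball (0 : E) (3 / 2)) := MeasureTheory.measure_mono hsub
      _ = _ := μ.addHaar_ball_of_pos _ (by norm_num)
  have h0 : μ (Metric.ball (0 : E) 1) ≠ 0 := (Metric.measure_ball_pos μ _ one_pos).ne'
  have htop : μ (Metric.ball (0 : E) 1) ≠ ∞ := MeasureTheory.measure_ball_lt_top.ne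
  rw [ENNReal.mul_le_mul_iff_left h0 htop, ← ENNReal.ofReal_natCast,
    ← ENNReal.ofReal_mul (by positivity), ENNReal.ofReal_le_ofReal_iff (by positivity),
    ← le_div_iff₀ (by positivity), ← div_pow] at hμ
  refine hμ.trans_eq (congrArg (· ^ _) ?_)
  field_simp

theorem exists_separated_cover_unitClosedBall {E : Type*} [NormedAddCommGroup E]
    [NormedSpace ℝ E] [FiniteDimensional ℝ E] {ε : ℝ} (hε : 0 < ε) (hε1 : ε ≤ 1) :
    ∃ s : Finset E, (s : Set E) ⊆ Metric.closedBall 0 1 ∧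
      ((s : Set E).Pairwise fun x y => ε ≤ dist x y) ∧
      Metric.closedBall (0 : E) 1 ⊆ ⋃ x ∈ s, Metric.closedBall x ε := by
  classical
  let S : Set ℕ := {m | ∃ s : Finset E, (s : Set E) ⊆ Metric.closedBall 0 1 ∧
    ((s : Set E).Pairwise fun x y => ε ≤ dist x y) ∧ s.card = m}
  have hbdd : BddAbove S := by
    refine ⟨⌊(3 / ε) ^ Module.finrank ℝ E⌋₊, ?_⟩
    rintro _ ⟨s, hs, hsep, rfl⟩
    exact Nat.le_floor (card_le_of_separated_unitClosedBall hε hε1 s hs hsep)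
  obtain ⟨s, hs, hsep, hcard⟩ : sSup S ∈ S := Nat.sSup_mem ⟨0, ∅, by simp⟩ hbdd
  refine ⟨s, hs, hsep, fun y hy => ?_⟩
  by_contra hcov
  simp only [mem_iUnion, Metric.mem_closedBall, not_exists, not_le] at hcov
  have hys : y ∉ s := fun h => by
    have := hcov y h
    rw [dist_self] at this
    exact this.not_ge hε.le
  have hmem : s.card + 1 ∈ S := by
    refine ⟨insert y s, ?_, ?_, Finset.card_insert_of_notMem hys⟩
    · rw [Finset.coe_insert]
      exact insert_subset hy hs
    · rw [Finset.coe_insert]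
      refine hsep.insert fun z hz _ => ⟨(hcov z hz).le, ?_⟩
      rw [dist_comm]
      exact (hcov z hz).le
  have := le_csSup hbdd hmem
  omega

theorem covT_bounds {E : Type*} [NormedAddCommGroup E] [NormedSpace ℝ E]
    [FiniteDimensional ℝ E] {ε : ℝ} (hε : 0 < ε) (hε1 : ε ≤ 1) :
    (1 / ε) ^ Module.finrank ℝ E ≤ (covT E ε : ℝ) ∧
      (covT E ε : ℝ) ≤ (3 / ε) ^ Module.finrank ℝ E := by
  obtain ⟨s, hs, hsep, hcov⟩ := exists_separated_cover_unitClosedBall (E := E) hε hε1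
  unfold covT
  simp_rw [vadd_smul_unitClosedBall _ hε]
  constructor
  · obtain ⟨t, -, ht, hcard⟩ := Nat.sInf_mem
      (s := {m : ℕ | ∃ s : Finset E, (s : Set E) ⊆ Metric.closedBall 0 1 ∧
        (Metric.closedBall (0 : E) 1 ⊆ ⋃ x ∈ s, Metric.closedBall x ε) ∧ s.card = m})
      ⟨_, s, hs, hcov, rfl⟩
    rw [← hcard]
    exact inv_pow_finrank_le_card_of_cover hε t ht
  · refine le_trans ?_ (card_le_of_separated_unitClosedBall hε hε1 s hs hsep)
    exact Nat.cast_le.2 (Nat.sInf_le ⟨s, hs, hcov, rfl⟩)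

theorem log_covT_bounds {E : Type*} [NormedAddCommGroup E] [NormedSpace ℝ E]
    [FiniteDimensional ℝ E] {ε : ℝ} (hε : 0 < ε) (hε1 : ε ≤ 1) :
    Module.finrank ℝ E * Real.log (1 / ε) ≤ Real.log (covT E ε) ∧
      Real.log (covT E ε) ≤ Module.finrank ℝ E * (Real.log (1 / ε) + Real.log 3) := by
  obtain ⟨h1, h2⟩ := covT_bounds (E := E) hε hε1
  have hpos : 0 < (1 / ε) ^ Module.finrank ℝ E := by positivity
  constructor
  · rw [← Real.log_pow]
    exact Real.log_le_log hpos h1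
  · rw [← Real.log_mul (by positivity) (by norm_num), ← Real.log_pow]
    refine (Real.log_le_log (hpos.trans_le h1) h2).trans_eq ?_
    congr 2
    ring

theorem tendsto_log_one_div_atTop :
    Tendsto (fun ε : ℝ => Real.log (1 / ε)) (𝓝[>] (0 : ℝ)) atTop := by
  simp_rw [one_div]
  exact Real.tendsto_log_atTop.comp tendsto_inv_nhdsGT_zero

theorem tendsto_add_mul_div {ι : Type*} {l : Filter ι} {f : ι → ℝ} (hf : Tendsto f l atTop)
    (a c : ℝ) : Tendsto (fun i => (c + a * f i) / f i) l (𝓝 a) := by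
  have h : Tendsto (fun i => c / f i + a) l (𝓝 (0 + a)) :=
    (hf.const_div_atTop c).add_const a
  rw [zero_add] at h
  refine h.congr' ?_
  filter_upwards [hf.eventually_gt_atTop 0] with i hi
  field_simp

theorem limsup_ofReal_div_ofReal {ι : Type*} {l : Filter ι} [l.NeBot] {f g : ι → ℝ} {a : ℝ}
    (hg : Tendsto g l atTop) (h : Tendsto (fun i => f i / g i) l (𝓝 a)) :
    limsup (fun i => ENNReal.ofReal (f i) / ENNReal.ofReal (g i)) l = ENNReal.ofReal a := by
  refine ((ENNReal.tendsto_ofReal h).congr' ?_).limsup_eq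
  filter_upwards [hg.eventually_gt_atTop 0] with i hi
  exact ENNReal.ofReal_div_of_pos hi

/-- for an `n`-dimensional real normed space (`n ≥ 1`),
`lim_{ε→0⁺} ln N(ε)/ln(1/ε) = n` and `lim_{ε→0⁺} ln ln N(ε)/ln ln (1/ε) = 1`;
in particular, the point-extended box dimension of `E` (given by
`limsup φ₁(N(ε))/φ₂(1/ε)`) equals `n` for `φ = (ln, ln)` and equals `1` for
`φ = (ln ∘ ln, ln ∘ ln)`. -/
theorem covT_asymptotics
    {E : Type*} [NormedAddCommGroup E] [NormedSpace ℝ E]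
    (n : ℕ) (hn : 1 ≤ n) (hdim : Module.finrank ℝ E = n) :
    Tendsto (fun ε : ℝ => Real.log (covT E ε) / Real.log (1 / ε))
      (𝓝[>] (0 : ℝ)) (𝓝 (n : ℝ)) ∧
    Tendsto (fun ε : ℝ => Real.log (Real.log (covT E ε)) / Real.log (Real.log (1 / ε)))
      (𝓝[>] (0 : ℝ)) (𝓝 (1 : ℝ)) ∧
    limsup (fun ε : ℝ =>
        ENNReal.ofReal (Real.log (covT E ε)) / ENNReal.ofReal (Real.log (1 / ε)))
      (𝓝[>] (0 : ℝ)) = (n : ℝ≥0∞) ∧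
    limsup (fun ε : ℝ =>
        ENNReal.ofReal (Real.log (Real.log (covT E ε))) /
          ENNReal.ofReal (Real.log (Real.log (1 / ε))))
      (𝓝[>] (0 : ℝ)) = (1 : ℝ≥0∞) := by
  have : FiniteDimensional ℝ E := Module.finite_of_finrank_pos (by omega)
  have hL := tendsto_log_one_div_atTop
  have hLL : Tendsto (fun ε : ℝ => Real.log (Real.log (1 / ε))) (𝓝[>] (0 : ℝ)) atTop :=
    Real.tendsto_log_atTop.comp hL
  have hn0 : (0 : ℝ) < n := by exact_mod_cast hn
  have hlog3 : 0 < Real.log 3 := Real.log_pos (by norm_num)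
  have hε1 : ∀ᶠ ε : ℝ in 𝓝[>] (0 : ℝ), 0 < ε ∧ ε ≤ 1 := Ioc_mem_nhdsGT one_pos
  have hlim : Tendsto (fun ε : ℝ => Real.log (covT E ε) / Real.log (1 / ε))
      (𝓝[>] (0 : ℝ)) (𝓝 (n : ℝ)) := by
    refine tendsto_of_tendsto_of_tendsto_of_le_of_le' (tendsto_add_mul_div hL n 0)
      (tendsto_add_mul_div hL n (n * Real.log 3)) ?_ ?_
    all_goals
      filter_upwards [hε1, hL.eventually_gt_atTop 0] with ε hε hpos
      obtain ⟨h1, h2⟩ := log_covT_bounds (E := E) hε.1 hε.2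
      rw [hdim] at h1 h2
      gcongr
      linarith
  have hlim' : Tendsto (fun ε : ℝ => Real.log (Real.log (covT E ε)) / Real.log (Real.log (1 / ε)))
      (𝓝[>] (0 : ℝ)) (𝓝 (1 : ℝ)) := by
    refine tendsto_of_tendsto_of_tendsto_of_le_of_le'
      (tendsto_add_mul_div hLL 1 (Real.log n))
      (tendsto_add_mul_div hLL 1 (Real.log (n * (1 + Real.log 3)))) ?_ ?_
    all_goals
      filter_upwards [hε1, hL.eventually_ge_atTop 1, hLL.eventually_gt_atTop 0] with ε hε hpos hpos'
      obtain ⟨h1, h2⟩ := log_covT_bounds (E := E) hε.1 hε.2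
      rw [hdim] at h1 h2
      have hnL : 0 < n * Real.log (1 / ε) := by positivity
      rw [one_mul]
      rw [← Real.log_mul (by positivity) (by positivity)]
      refine div_le_div_of_nonneg_right (Real.log_le_log (by linarith) ?_) hpos'.le
    · exact h1
    · refine h2.trans ?_
      rw [mul_assoc]
      gcongr
      nlinarith
  refine ⟨hlim, hlim', ?_, ?_⟩
  · rw [limsup_ofReal_div_ofReal hL hlim, ENNReal.ofReal_natCast]
  · rw [limsup_ofReal_div_ofReal hLL hlim', ENNReal.ofReal_one]

end
end

section
/- Let p be a prime, equip ℚ_p with the p-adic metric d(x, y) = |x − y|_p, and let φ ∈ Φ. Then for every x ∈ ℚ_p, dim_φ{x}_{ℚ_p} = limsup_{m→∞} φ₁(p^m)/φ₂(p^m). In particular, if φ₁ = φ₂ then dim_φ{x}_{ℚ_p} = 1 for every x ∈ ℚ_p; thus both the box dimension (φ = (ln, ln)) and the functional dimension (φ = (ln∘ln, ln∘ln)) of ℚ_p equal 1. -/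
open Filter Topology Set
open scoped ENNReal ENat Classical

noncomputable section

/-- The covering number `N(ε, A)` in a metric space: the least `n` such that `A` can be
covered by `n` closed balls of radius `ε/2` with centers in `A`; `∞` if there is no
finite such cover. -/
def covNum {X : Type*} [PseudoMetricSpace X] (ε : ℝ) (A : Set X) : ℕ∞ :=
  sInf {n : ℕ∞ | ∃ s : Finset X, (↑s : Set X) ⊆ A ∧
    (A ⊆ ⋃ c ∈ s, Metric.closedBall c (ε / 2)) ∧ (s.card : ℕ∞) = n}

/-- The relative point-extended box dimension `dim_φ{x}_A` in a metric space. -/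
def pointDimM {X : Type*} [PseudoMetricSpace X] (φ₁ φ₂ : ℝ → ℝ) (x : X) (A : Set X) :
    ℝ≥0∞ :=
  ⨅ r ∈ Set.Ioi (0 : ℝ),
    limsup (fun ε : ℝ =>
        phiApp φ₁ (covNum ε (Metric.closedBall x r ∩ A)) / ENNReal.ofReal (φ₂ (1 / ε)))
      (𝓝[>] (0 : ℝ))


/-- Scale functions agree asymptotically along comparable arguments. -/
theorem IsScale.tendsto_div_of_comparable {φ : ℝ → ℝ} (h : IsScale φ) {α : Type*} {l : Filter α}
    {u v : α → ℝ} (hu : Tendsto u l atTop) (hv : Tendsto v l atTop) (C : ℝ)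
    (huv : ∀ᶠ a in l, u a ≤ C * v a) (hvu : ∀ᶠ a in l, v a ≤ C * u a) :
    Tendsto (fun a => φ (u a) / φ (v a)) l (𝓝 1) := by
  have key : ∀ k : ℕ, Tendsto (fun t : ℝ => φ (2 ^ k * t) / φ t) atTop (𝓝 1) := by
    intro k
    induction k with
    | zero =>
      refine tendsto_const_nhds.congr' ?_
      filter_upwards [eventually_gt_atTop 0] with t ht
      simp [(h.pos ht).ne']
    | succ k ih =>
      have h2 : Tendsto (fun t : ℝ => 2 ^ k * t) atTop atTop :=
        tendsto_id.const_mul_atTop (by positivity)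
      have h3 := (h.tendsto_ratio.comp h2).mul ih
      rw [mul_one] at h3
      refine h3.congr' ?_
      filter_upwards [eventually_gt_atTop 0] with t ht
      have h4 : φ (2 ^ k * t) ≠ 0 := (h.pos (by positivity)).ne'
      have h5 : φ t ≠ 0 := (h.pos ht).ne'
      simp only [Function.comp]
      rw [pow_succ', mul_assoc]
      field_simp
  obtain ⟨k, hk⟩ := pow_unbounded_of_one_lt C (one_lt_two)
  have upper := (key k).comp hv
  have lower := ((key k).comp hu).inv₀ one_ne_zero
  rw [inv_one] at lower
  refine tendsto_of_tendsto_of_tendsto_of_le_of_le' lower upper ?_ ?_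
  · filter_upwards [hvu, hu.eventually_gt_atTop 0, hv.eventually_gt_atTop 0] with a ha hua hva
    simp only [Function.comp, inv_div]
    have := h.pos hua
    exact div_le_div_of_nonneg_left this.le (h.pos hva)
      (h.mono hva (ha.trans (by gcongr)))
  · filter_upwards [huv, hu.eventually_gt_atTop 0, hv.eventually_gt_atTop 0] with a ha hua hva
    simp only [Function.comp]
    exact div_le_div_of_nonneg_right (h.mono hua (ha.trans (by gcongr))) (h.pos hva).le

theorem Padic.norm_le_iff_norm_le_zpow {p : ℕ} [Fact p.Prime] {k : ℤ} {r : ℝ}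
    (h₁ : (p : ℝ) ^ k ≤ r) (h₂ : r < (p : ℝ) ^ (k + 1)) (x : ℚ_[p]) :
    ‖x‖ ≤ r ↔ ‖x‖ ≤ (p : ℝ) ^ k :=
  ⟨fun h => (Padic.norm_le_pow_iff_norm_lt_pow_add_one x k).2 (h.trans_lt h₂),
    fun h => h.trans h₁⟩

/-- A `p`-adic ball of radius about `p ^ a` needs exactly `p ^ n` balls of radius
about `p ^ (a - n)`. -/
theorem covNum_padic_closedBall {p : ℕ} [hp : Fact p.Prime] (x : ℚ_[p]) {a : ℤ} {n : ℕ} {r ε : ℝ}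
    (hr₁ : (p : ℝ) ^ a ≤ r) (hr₂ : r < (p : ℝ) ^ (a + 1))
    (hε₁ : (p : ℝ) ^ (a - n) ≤ ε / 2) (hε₂ : ε / 2 < (p : ℝ) ^ (a - n + 1)) :
    covNum ε (Metric.closedBall x r) = ((p ^ n : ℕ) : ℕ∞) := by
  have hp0 : (0 : ℝ) < p := mod_cast hp.1.pos
  have hpq : (p : ℚ_[p]) ≠ 0 := mod_cast hp.1.ne_zero
  let g : ℕ → ℚ_[p] := fun i => x + (p : ℚ_[p]) ^ (-a) * i
  have g_mem : ∀ i, g i ∈ Metric.closedBall x r := by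
    intro i
    rw [Metric.mem_closedBall, dist_eq_norm, Padic.norm_le_iff_norm_le_zpow hr₁ hr₂]
    simp only [g, add_sub_cancel_left, norm_mul, Padic.norm_p_zpow, neg_neg]
    refine mul_le_of_le_one_right (by positivity) ?_
    exact_mod_cast Padic.norm_int_le_one (p := p) i
  have g_sep : ∀ i < p ^ n, ∀ j < p ^ n, ‖g i - g j‖ ≤ ε / 2 → i = j := by
    intro i hi j hj h
    rw [Padic.norm_le_iff_norm_le_zpow hε₁ hε₂] at h
    have e : g i - g j = (p : ℚ_[p]) ^ (-a) * ((i - j : ℤ) : ℚ_[p]) := by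
      simp only [g]; push_cast; ring
    rw [e, norm_mul, Padic.norm_p_zpow, neg_neg, sub_eq_add_neg a, zpow_add₀ hp0.ne'] at h
    have h' := le_of_mul_le_mul_left h (by positivity)
    rw [Padic.norm_int_le_pow_iff_dvd] at h'
    have h1 : (j : ℤ) ≡ i [ZMOD ((p ^ n : ℕ) : ℤ)] := by
      rw [Int.modEq_iff_dvd]; exact_mod_cast h'
    have h2 := Int.natCast_modEq_iff.1 h1
    exact (h2.eq_of_lt_of_lt hj hi).symm
  apply le_antisymm
  · apply sInf_le
    refine ⟨(Finset.range (p ^ n)).image g, ?_, ?_, ?_⟩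
    · intro y hy
      simp only [Finset.coe_image, Set.mem_image] at hy
      obtain ⟨i, -, rfl⟩ := hy
      exact g_mem i
    · intro y hy
      rw [Metric.mem_closedBall, dist_eq_norm, Padic.norm_le_iff_norm_le_zpow hr₁ hr₂] at hy
      have hz : ‖(p : ℚ_[p]) ^ a * (y - x)‖ ≤ 1 := by
        rw [norm_mul, Padic.norm_p_zpow, zpow_neg]
        rwa [inv_mul_le_iff₀ (by positivity), mul_one]
      obtain ⟨z, hzy⟩ : ∃ z : ℤ_[p], (z : ℚ_[p]) = (p : ℚ_[p]) ^ a * (y - x) := ⟨⟨_, hz⟩, rfl⟩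
      have hs := (PadicInt.norm_le_pow_iff_mem_span_pow _ n).2 (PadicInt.appr_spec n z)
      rw [PadicInt.norm_def, PadicInt.coe_sub, PadicInt.coe_natCast] at hs
      simp only [Set.mem_iUnion]
      refine ⟨g (z.appr n), Finset.mem_image_of_mem g (Finset.mem_range.2 (z.appr_lt n)), ?_⟩
      rw [Metric.mem_closedBall, dist_eq_norm, Padic.norm_le_iff_norm_le_zpow hε₁ hε₂]
      have e : y - g (z.appr n) = (p : ℚ_[p]) ^ (-a) * (z - z.appr n) := by
        rw [hzy, mul_sub, ← mul_assoc, ← zpow_add₀ hpq, neg_add_cancel, zpow_zero]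
        simp only [g]
        ring
      rw [e, norm_mul, Padic.norm_p_zpow, neg_neg, sub_eq_add_neg a, zpow_add₀ hp0.ne']
      gcongr
    · rw [Finset.card_image_of_injOn, Finset.card_range]
      intro i hi j hj hij
      have hi' := Finset.mem_range.1 hi
      have hj' := Finset.mem_range.1 hj
      refine g_sep i hi' j hj' ?_
      rw [hij, sub_self, norm_zero]
      exact le_trans (by positivity) hε₁
  · refine le_sInf ?_
    rintro _ ⟨s, -, hcov, rfl⟩
    have hc : ∀ i, ∃ c ∈ s, ‖g i - c‖ ≤ ε / 2 := by
      intro i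
      have := hcov (g_mem i)
      simpa only [Set.mem_iUnion, exists_prop, Metric.mem_closedBall, dist_eq_norm] using this
    choose c hcs hcd using hc
    have : (Finset.range (p ^ n)).card ≤ s.card := by
      refine Finset.card_le_card_of_injOn c (fun i _ => hcs i) ?_
      intro i hi j hj hij
      refine g_sep i (Finset.mem_range.1 hi) j (Finset.mem_range.1 hj) ?_
      have e : g i - g j = (g i - c i) + (c j - g j) := by rw [hij]; ring
      rw [e]
      have h2 := hcd j
      rw [norm_sub_rev] at h2
      exact (Padic.nonarchimedean _ _).trans (max_le (hcd i) h2)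
    rw [Finset.card_range] at this
    exact_mod_cast this

theorem ENNReal.limsup_mul_of_tendsto_one {α : Type*} {l : Filter α} [l.NeBot] (u : α → ℝ≥0∞)
    {v : α → ℝ≥0∞} (hv : Tendsto v l (𝓝 1)) :
    limsup (u * v) l = limsup u l := by
  apply le_antisymm
  · have := ENNReal.limsup_mul_le' (u := u) (v := v) (f := l)
      (by rw [hv.limsup_eq]; simp) (by rw [hv.limsup_eq]; simp)
    rwa [hv.limsup_eq, mul_one] at this
  · have := ENNReal.le_limsup_mul (u := u) (v := v) (f := l)
    rwa [hv.liminf_eq, mul_one] at this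

theorem phiApp_natCast (φ : ℝ → ℝ) (k : ℕ) : phiApp φ k = ENNReal.ofReal (φ k) := by
  rw [phiApp, if_neg (ENat.natCast_ne_top k), ENat.toNat_natCast]

/-- The upper growth rate of the covering numbers of a `p`-adic ball. -/
theorem limsup_covNum_padic_closedBall {p : ℕ} [hp : Fact p.Prime] (φ₁ : ℝ → ℝ) {φ₂ : ℝ → ℝ}
    (h₂ : IsScale φ₂) (x : ℚ_[p]) {r : ℝ} (hr : 0 < r) :
    limsup (fun ε : ℝ =>
        phiApp φ₁ (covNum ε (Metric.closedBall x r)) / ENNReal.ofReal (φ₂ (1 / ε)))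
      (𝓝[>] (0 : ℝ)) =
    limsup (fun m : ℕ =>
        ENNReal.ofReal (φ₁ ((p : ℝ) ^ m)) / ENNReal.ofReal (φ₂ ((p : ℝ) ^ m))) atTop := by
  have hp0 : (0 : ℝ) < p := mod_cast hp.1.pos
  have hp1 : 1 < p := hp.1.one_lt
  have hp1' : (1 : ℝ) < p := mod_cast hp1
  let a := Int.log p r
  have ha₁ : (p : ℝ) ^ a ≤ r := Int.zpow_log_le_self hp1 hr
  have ha₂ : r < (p : ℝ) ^ (a + 1) := Int.lt_zpow_succ_log_self hp1 r
  let n : ℝ → ℕ := fun ε => (a - Int.log p (ε / 2)).toNat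
  have hpos : ∀ᶠ ε : ℝ in 𝓝[>] 0, 0 < ε := eventually_mem_nhdsWithin
  have hsmall : ∀ δ : ℝ, 0 < δ → ∀ᶠ ε : ℝ in 𝓝[>] 0, ε / 2 < δ := by
    intro δ hδ
    filter_upwards [Ioo_mem_nhdsGT hδ] with ε hε
    have := hε.1
    have := hε.2
    linarith
  have hn : Tendsto n (𝓝[>] 0) atTop := by
    refine tendsto_atTop.2 fun N => ?_
    filter_upwards [hpos, hsmall ((p : ℝ) ^ (a - N)) (by positivity)] with ε hε h
    have := (Int.lt_zpow_iff_log_lt hp1 (half_pos hε)).1 h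
    simp only [n]
    omega
  let σ : ℕ → ℝ := fun m => 2 * (p : ℝ) ^ (a - m)
  have hσ : Tendsto σ atTop (𝓝[>] 0) := by
    refine tendsto_nhdsWithin_iff.2 ⟨?_, Eventually.of_forall fun m => ?_⟩
    · have h := (tendsto_pow_atTop_nhds_zero_of_lt_one (inv_nonneg.2 hp0.le)
        (inv_lt_one_of_one_lt₀ hp1')).const_mul (2 * (p : ℝ) ^ a)
      rw [mul_zero] at h
      refine h.congr fun m => ?_
      simp only [σ]
      rw [zpow_sub₀ hp0.ne', zpow_natCast, inv_pow]
      ring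
    · simp only [σ, Set.mem_Ioi]
      positivity
  have hnσ : n ∘ σ = id := by
    funext m
    simp only [n, σ, Function.comp, id]
    rw [mul_div_cancel_left₀ _ two_ne_zero, Int.log_zpow hp1]
    omega
  have hmap : map n (𝓝[>] 0) = atTop := by
    refine le_antisymm hn ?_
    calc atTop = map n (map σ atTop) := by rw [map_map, hnσ, map_id]
      _ ≤ map n (𝓝[>] 0) := map_mono hσ
  have hbounds : ∀ᶠ ε : ℝ in 𝓝[>] 0,
      (p : ℝ) ^ (a - n ε) ≤ ε / 2 ∧ ε / 2 < (p : ℝ) ^ (a - n ε + 1) := by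
    filter_upwards [hpos, hsmall ((p : ℝ) ^ a) (by positivity)] with ε hε h
    have h1 := (Int.lt_zpow_iff_log_lt hp1 (half_pos hε)).1 h
    have e : a - n ε = Int.log p (ε / 2) := by
      simp only [n]
      omega
    rw [e]
    exact ⟨Int.zpow_log_le_self hp1 (half_pos hε), Int.lt_zpow_succ_log_self hp1 _⟩
  let C : ℝ := max (2 * (p : ℝ) ^ (a + 1)) (2 * (p : ℝ) ^ a)⁻¹
  have hpn : Tendsto (fun ε => (p : ℝ) ^ n ε) (𝓝[>] 0) atTop :=
    (tendsto_pow_atTop_atTop_of_one_lt hp1').comp hn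
  have hinv : Tendsto (fun ε : ℝ => 1 / ε) (𝓝[>] 0) atTop := by
    simpa only [one_div] using tendsto_inv_nhdsGT_zero (𝕜 := ℝ)
  have hratio : Tendsto (fun ε => φ₂ ((p : ℝ) ^ n ε) / φ₂ (1 / ε)) (𝓝[>] 0) (𝓝 1) := by
    refine h₂.tendsto_div_of_comparable hpn hinv C ?_ ?_
    · filter_upwards [hpos, hbounds] with ε hε h
      have h' := h.2
      rw [show a - n ε + 1 = (a + 1) - n ε by ring, zpow_sub₀ hp0.ne', zpow_natCast,
        lt_div_iff₀ (by positivity)] at h'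
      rw [mul_one_div, le_div_iff₀ hε]
      have := le_max_left (2 * (p : ℝ) ^ (a + 1)) (2 * (p : ℝ) ^ a)⁻¹
      simp only [C]
      linarith
    · filter_upwards [hpos, hbounds] with ε hε h
      have h' := h.1
      rw [zpow_sub₀ hp0.ne', zpow_natCast, div_le_iff₀ (by positivity)] at h'
      have hC : (2 * (p : ℝ) ^ a)⁻¹ ≤ C := le_max_right _ _
      rw [div_le_iff₀ hε]
      calc (1 : ℝ) = (2 * (p : ℝ) ^ a)⁻¹ * (2 * (p : ℝ) ^ a) := by
            rw [inv_mul_cancel₀]; positivity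
        _ ≤ C * ((p : ℝ) ^ n ε * ε) := by
            refine mul_le_mul hC (by linarith) (by positivity) (le_trans (by positivity) hC)
        _ = C * (p : ℝ) ^ n ε * ε := by ring
  have hratio' : Tendsto (fun ε => ENNReal.ofReal (φ₂ ((p : ℝ) ^ n ε) / φ₂ (1 / ε)))
      (𝓝[>] 0) (𝓝 1) := by
    simpa using ENNReal.tendsto_ofReal hratio
  let G : ℕ → ℝ≥0∞ := fun m =>
    ENNReal.ofReal (φ₁ ((p : ℝ) ^ m)) / ENNReal.ofReal (φ₂ ((p : ℝ) ^ m))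
  have hG : limsup G atTop = limsup (G ∘ n) (𝓝[>] 0) := by
    rw [← hmap, limsup_comp]
  change _ = limsup G atTop
  rw [hG, ← ENNReal.limsup_mul_of_tendsto_one (G ∘ n) hratio']
  refine limsup_congr ?_
  filter_upwards [hpos, hbounds] with ε hε h
  rw [covNum_padic_closedBall x ha₁ ha₂ h.1 h.2]
  have q1 : 0 < φ₂ ((p : ℝ) ^ n ε) := h₂.pos (by positivity)
  have q2 : 0 < φ₂ (1 / ε) := h₂.pos (by positivity)
  rw [phiApp_natCast, Nat.cast_pow]
  simp only [Pi.mul_apply, Function.comp, G]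
  rw [ENNReal.ofReal_div_of_pos q2, ← mul_div_assoc, ENNReal.div_mul_cancel]
  · simpa using q1
  · exact ENNReal.ofReal_ne_top

/-- for the `p`-adic field with its standard metric and `φ ∈ Φ`,
`dim_φ{x}_{ℚ_p} = limsup_m φ₁(p^m)/φ₂(p^m)` for every `x`; in particular if `φ₁ = φ₂`
(e.g. for the box dimension `(ln,ln)` and the functional dimension `(ln∘ln,ln∘ln)`),
this dimension equals `1`. -/
theorem pointDimM_padic (p : ℕ) [Fact p.Prime]
    (φ₁ φ₂ : ℝ → ℝ) (h₁ : IsScale φ₁) (h₂ : IsScale φ₂) :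
    (∀ x : ℚ_[p], pointDimM φ₁ φ₂ x (Set.univ : Set ℚ_[p]) =
        limsup (fun m : ℕ =>
            ENNReal.ofReal (φ₁ ((p : ℝ) ^ m)) / ENNReal.ofReal (φ₂ ((p : ℝ) ^ m)))
          atTop) ∧
    (φ₁ = φ₂ → ∀ x : ℚ_[p], pointDimM φ₁ φ₂ x (Set.univ : Set ℚ_[p]) = 1) := by
  have main : ∀ x : ℚ_[p], pointDimM φ₁ φ₂ x (Set.univ : Set ℚ_[p]) =
      limsup (fun m : ℕ =>
        ENNReal.ofReal (φ₁ ((p : ℝ) ^ m)) / ENNReal.ofReal (φ₂ ((p : ℝ) ^ m))) atTop := by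
    intro x
    simp only [pointDimM, Set.inter_univ]
    refine (biInf_congr fun r hr => limsup_covNum_padic_closedBall φ₁ h₂ x hr).trans ?_
    exact biInf_const ⟨1, Set.mem_Ioi.2 one_pos⟩
  refine ⟨main, ?_⟩
  rintro rfl x
  rw [main x]
  have hp0 : (0 : ℝ) < p := mod_cast (Fact.out : p.Prime).pos
  have : (fun m : ℕ => ENNReal.ofReal (φ₁ ((p : ℝ) ^ m)) / ENNReal.ofReal (φ₁ ((p : ℝ) ^ m))) =
      fun _ => 1 := by
    funext m
    exact ENNReal.div_self (by simpa using h₁.pos (pow_pos hp0 m)) ENNReal.ofReal_ne_top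
  rw [this, limsup_const]

end
end

section
/- Let 1 < p < ∞, let B be the closed unit ball of the real sequence space ℓ^p, and equip B with the metric d_p. For ε > 0 let N(ε) be the least number of closed d_p-balls of radius ε with centers in B needed to cover B (this number is finite since (B, d_p) is compact). Then limsup_{ε→0⁺} ln N(ε) / ln(1/ε) = ∞; that is, (B, d_p) has infinite box dimension. -/
open Filter Topology Set
open scoped ENNReal ENat Classical

noncomputable section

/-- The closed unit ball of the real sequence space `ℓ^p`, realized inside the space of
all real sequences: those `x` with `Σ_k |x k|^p ≤ 1` (the sum computed in `[0,∞]`, so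
membership forces `p`-summability). -/
def ellpBall (p : ℝ) : Set (ℕ → ℝ) :=
  {x : ℕ → ℝ | ∑' k : ℕ, ENNReal.ofReal (|x k| ^ p) ≤ 1}

/-- The metric `d_p(x,y) = (Σ_{k≥1} 4^{-k} |x(k) - y(k)|^p)^{1/p}` (sequences indexed by
`ℕ`, the `k`-th entry playing the role of `x(k+1)`). It induces the weak topology on
bounded subsets of `ℓ^p`. -/
def dLp (p : ℝ) (x y : ℕ → ℝ) : ℝ :=
  (∑' k : ℕ, (4 : ℝ)⁻¹ ^ (k + 1) * |x k - y k| ^ p) ^ (1 / p)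

/-- The least number of closed `d_p`-balls of radius `ε` with centers in the unit ball of
`ℓ^p` needed to cover the unit ball; `∞` if there is no finite such cover. -/
def covB (p : ℝ) (ε : ℝ) : ℕ∞ :=
  sInf {n : ℕ∞ | ∃ s : Finset (ℕ → ℝ), (↑s : Set (ℕ → ℝ)) ⊆ ellpBall p ∧
    (ellpBall p ⊆ ⋃ c ∈ s, {y : ℕ → ℝ | dLp p c y ≤ ε}) ∧ (s.card : ℕ∞) = n}

theorem abs_le_one_of_mem_ellpBall {p : ℝ} (hp : 0 < p) {x : ℕ → ℝ} (hx : x ∈ ellpBall p)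
    (k : ℕ) : |x k| ≤ 1 := by
  have h : ENNReal.ofReal (|x k| ^ p) ≤ 1 := (ENNReal.le_tsum k).trans hx
  rw [ENNReal.ofReal_le_one] at h
  by_contra! hlt
  exact absurd h (not_le.2 (Real.one_lt_rpow hlt hp))

theorem inv_four_pow_mul_abs_sub_le_dLp {p : ℝ} (hp : 1 < p) {x y : ℕ → ℝ}
    (hx : x ∈ ellpBall p) (hy : y ∈ ellpBall p) (k : ℕ) :
    (4 : ℝ)⁻¹ ^ (k + 1) * |x k - y k| ≤ dLp p x y := by
  have hp0 : 0 < p := by linarith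
  have hdiff (j : ℕ) : |x j - y j| ≤ 2 := by
    have h1 := abs_le_one_of_mem_ellpBall hp0 hx j
    have h2 := abs_le_one_of_mem_ellpBall hp0 hy j
    have h3 := abs_sub (x j) (y j)
    linarith
  have hnn (j : ℕ) : 0 ≤ (4 : ℝ)⁻¹ ^ (j + 1) * |x j - y j| ^ p := by positivity
  have hgeom : Summable fun j : ℕ => (4 : ℝ)⁻¹ ^ (j + 1) * 2 ^ p :=
    ((summable_nat_add_iff 1).2
      (summable_geometric_of_lt_one (by norm_num) (by norm_num))).mul_right _
  have hsum : Summable fun j : ℕ => (4 : ℝ)⁻¹ ^ (j + 1) * |x j - y j| ^ p := by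
    refine Summable.of_nonneg_of_le hnn (fun j => ?_) hgeom
    gcongr
    exact hdiff j
  have hterm : (4 : ℝ)⁻¹ ^ (k + 1) * |x k - y k| ^ p ≤
      ∑' j : ℕ, (4 : ℝ)⁻¹ ^ (j + 1) * |x j - y j| ^ p :=
    hsum.le_tsum k fun j _ => hnn j
  have hweight : ((4 : ℝ)⁻¹ ^ (k + 1)) ^ p ≤ (4 : ℝ)⁻¹ ^ (k + 1) :=
    Real.rpow_le_self_of_le_one (by positivity) (pow_le_one₀ (by norm_num) (by norm_num)) hp.le
  rw [dLp, one_div, Real.le_rpow_inv_iff_of_pos (by positivity) (tsum_nonneg hnn) hp0,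
    Real.mul_rpow (by positivity) (abs_nonneg _)]
  exact le_trans (by gcongr) hterm

/-- The point of the grid of mesh `1 / (n * M)` on the first `n` coordinates with index `j`. -/
def gridPoint {n M : ℕ} (j : Fin n → Fin M) (k : ℕ) : ℝ :=
  if h : k < n then ((j ⟨k, h⟩ : ℕ) : ℝ) / (n * M) else 0

theorem gridPoint_mem_ellpBall {p : ℝ} (hp : 1 < p) {n M : ℕ} (j : Fin n → Fin M) :
    gridPoint j ∈ ellpBall p := by
  have hp0 : p ≠ 0 := by linarith
  change ∑' k : ℕ, ENNReal.ofReal (|gridPoint j k| ^ p) ≤ 1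
  rw [tsum_eq_sum (s := Finset.range n)
    (fun k hk => by simp [gridPoint, Finset.mem_range.not.1 hk, Real.zero_rpow hp0])]
  rw [← ENNReal.ofReal_sum_of_nonneg (fun k _ => by positivity), ENNReal.ofReal_le_one]
  have hle (k : ℕ) (hk : k ∈ Finset.range n) : |gridPoint j k| ^ p ≤ 1 / n := by
    have hk' := Finset.mem_range.1 hk
    have hn : (1 : ℝ) ≤ n := by exact_mod_cast (by omega : 1 ≤ n)
    have hj : ((j ⟨k, hk'⟩ : ℕ) : ℝ) ≤ M := by exact_mod_cast (j ⟨k, hk'⟩).2.le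
    have hM : (0 : ℝ) < M := by exact_mod_cast (j ⟨k, hk'⟩).pos
    have hval : |gridPoint j k| ≤ 1 / n := by
      rw [gridPoint, dif_pos hk', abs_of_nonneg (by positivity),
        div_le_div_iff₀ (by positivity) (by positivity)]
      nlinarith
    refine (Real.rpow_le_self_of_le_one (abs_nonneg _) (hval.trans ?_) hp.le).trans hval
    rw [div_le_one (by positivity)]
    exact hn
  refine (Finset.sum_le_sum hle).trans ?_
  rw [Finset.sum_const, Finset.card_range, nsmul_eq_mul, mul_one_div]
  exact div_self_le_one _

theorem eq_of_dLp_gridPoint_le {p : ℝ} (hp : 1 < p) {n M : ℕ} {ε : ℝ}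
    (hε : 2 * 4 ^ n * (n * M) * ε < 1) {c : ℕ → ℝ} (hc : c ∈ ellpBall p)
    {i j : Fin n → Fin M} (hi : dLp p c (gridPoint i) ≤ ε) (hj : dLp p c (gridPoint j) ≤ ε) :
    i = j := by
  funext ⟨k, hk⟩
  have hn : (0 : ℝ) < n := by exact_mod_cast (by omega : 0 < n)
  have hM : (0 : ℝ) < M := by exact_mod_cast (i ⟨k, hk⟩).pos
  have close {l : Fin n → Fin M} (hl : dLp p c (gridPoint l) ≤ ε) :
      |c k - gridPoint l k| ≤ 4 ^ n * ε := by
    have h := (inv_four_pow_mul_abs_sub_le_dLp hp hc (gridPoint_mem_ellpBall hp l) k).trans hl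
    have hε0 : 0 ≤ ε := le_trans (by positivity) h
    rw [inv_pow, inv_mul_le_iff₀ (by positivity)] at h
    refine h.trans ?_
    gcongr
    · norm_num
    · exact hk
  have h : |gridPoint i k - gridPoint j k| ≤ 2 * 4 ^ n * ε := by
    have h1 := abs_sub_le (gridPoint i k) (c k) (gridPoint j k)
    rw [abs_sub_comm (gridPoint i k) (c k)] at h1
    linarith [close hi, close hj]
  simp only [gridPoint, dif_pos hk] at h
  rw [← sub_div, abs_div, abs_of_pos (mul_pos hn hM), div_le_iff₀ (mul_pos hn hM)] at h
  have hlt : |((i ⟨k, hk⟩ : ℕ) : ℝ) - ((j ⟨k, hk⟩ : ℕ) : ℝ)| < 1 := by nlinarith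
  have hint : |((i ⟨k, hk⟩ : ℕ) : ℤ) - ((j ⟨k, hk⟩ : ℕ) : ℤ)| < 1 := by exact_mod_cast hlt
  rw [Int.abs_lt_one_iff] at hint
  exact Fin.ext (by omega)

theorem pow_le_covB {p : ℝ} (hp : 1 < p) {n M : ℕ} {ε : ℝ}
    (hε : 2 * 4 ^ n * (n * M) * ε < 1) : ((M ^ n : ℕ) : ℕ∞) ≤ covB p ε := by
  refine le_sInf ?_
  rintro _ ⟨s, hs, hcov, rfl⟩
  have hex (j : Fin n → Fin M) : ∃ c ∈ s, dLp p c (gridPoint j) ≤ ε := by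
    simpa using hcov (gridPoint_mem_ellpBall hp j)
  choose F hFs hF using hex
  have hcard := Finset.card_le_card_of_injOn (s := Finset.univ) (t := s) F
    (fun j _ => hFs j)
    (fun i _ j _ hij => eq_of_dLp_gridPoint_le hp hε (hs (hFs i)) (hF i) (hij ▸ hF j))
  simp only [Finset.card_univ, Fintype.card_fun, Fintype.card_fin] at hcard
  exact_mod_cast hcard

theorem le_phiApp_log_covB_div {p : ℝ} (hp : 1 < p) {n M : ℕ} (hn : 1 ≤ n)
    (hM : 3 * 4 ^ n * n ≤ M) :
    ENNReal.ofReal (n / 2) ≤ phiApp Real.log (covB p (3 * 4 ^ n * n * M : ℝ)⁻¹) /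
      ENNReal.ofReal (Real.log (1 / (3 * 4 ^ n * n * M : ℝ)⁻¹)) := by
  have hn' : (1 : ℝ) ≤ n := by exact_mod_cast hn
  have hC : (3 : ℝ) ≤ 3 * 4 ^ n * n := by
    have h4 : (1 : ℝ) ≤ 4 ^ n := one_le_pow₀ (by norm_num)
    nlinarith
  have hM' : (3 * 4 ^ n * n : ℝ) ≤ M := by exact_mod_cast hM
  have hM0 : (0 : ℝ) < M := by linarith
  have hcov : ((M ^ n : ℕ) : ℕ∞) ≤ covB p (3 * 4 ^ n * n * M : ℝ)⁻¹ := by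
    refine pow_le_covB hp ?_
    rw [← div_eq_mul_inv, div_lt_one (by positivity)]
    have : (0 : ℝ) < 4 ^ n * n * M := by positivity
    linarith
  have hlogM : 0 < Real.log M := Real.log_pos (by linarith)
  have hlog : Real.log (1 / (3 * 4 ^ n * n * M : ℝ)⁻¹) ≤ 2 * Real.log M := by
    rw [one_div, inv_inv, Real.log_mul (by positivity) hM0.ne']
    linarith [Real.log_le_log (by linarith) hM']
  have hlog0 : 0 < Real.log (1 / (3 * 4 ^ n * n * M : ℝ)⁻¹) := by
    rw [one_div, inv_inv]
    exact Real.log_pos (by nlinarith)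
  rw [ENNReal.le_div_iff_mul_le (Or.inl (by simpa using hlog0)) (Or.inl ENNReal.ofReal_ne_top)]
  by_cases htop : covB p (3 * 4 ^ n * n * M : ℝ)⁻¹ = ⊤
  · rw [phiApp, if_pos htop]
    exact le_top
  rw [phiApp, if_neg htop, ← ENNReal.ofReal_mul (by positivity)]
  refine ENNReal.ofReal_le_ofReal ?_
  have hnat : M ^ n ≤ (covB p (3 * 4 ^ n * n * M : ℝ)⁻¹).toNat := by
    simpa only [ENat.toNat_natCast] using ENat.toNat_le_toNat hcov htop
  have hreal : (M : ℝ) ^ n ≤ ((covB p (3 * 4 ^ n * n * M : ℝ)⁻¹).toNat : ℝ) := by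
    exact_mod_cast hnat
  calc n / 2 * Real.log (1 / (3 * 4 ^ n * n * M : ℝ)⁻¹)
      ≤ n / 2 * (2 * Real.log M) := by gcongr
    _ = Real.log ((M : ℝ) ^ n) := by rw [Real.log_pow]; ring
    _ ≤ _ := Real.log_le_log (by positivity) hreal

/-- for `1 < p < ∞`, the unit ball of `ℓ^p` equipped with the weak metric
`d_p` has infinite box dimension: `limsup_{ε→0⁺} ln N(ε) / ln (1/ε) = ∞`. -/
theorem ellpBall_infinite_box_dimension (p : ℝ) (hp : 1 < p) :
    limsup (fun ε : ℝ =>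
        phiApp Real.log (covB p ε) / ENNReal.ofReal (Real.log (1 / ε)))
      (𝓝[>] (0 : ℝ)) = ⊤ := by
  have htends {n : ℕ} (hn : 1 ≤ n) :
      Tendsto (fun M : ℕ => (3 * 4 ^ n * n * M : ℝ)⁻¹) atTop (𝓝[>] (0 : ℝ)) := by
    have hn' : (0 : ℝ) < n := by exact_mod_cast hn
    exact tendsto_inv_atTop_nhdsGT_zero.comp
      (tendsto_natCast_atTop_atTop.const_mul_atTop (by positivity))
  have hlower {n : ℕ} (hn : 1 ≤ n) : ENNReal.ofReal (n / 2) ≤ limsup (fun ε : ℝ =>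
      phiApp Real.log (covB p ε) / ENNReal.ofReal (Real.log (1 / ε))) (𝓝[>] (0 : ℝ)) := by
    refine le_limsup_of_frequently_le ((htends hn).frequently (Eventually.frequently ?_))
    filter_upwards [eventually_ge_atTop (3 * 4 ^ n * n)] with M hM
    exact le_phiApp_log_covB_div hp hn hM
  refine ENNReal.eq_top_of_forall_nnreal_le fun r => ?_
  obtain ⟨m, hm⟩ := exists_nat_ge (2 * (r : ℝ))
  refine le_trans ?_ (hlower (n := m + 1) (by omega))
  rw [← ENNReal.ofReal_coe_nnreal]
  refine ENNReal.ofReal_le_ofReal ?_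
  push_cast
  linarith

end
end

section
/- Let 1 < p < ∞ with conjugate exponent q (1/p + 1/q = 1), let (x_n) be a bounded sequence in the real sequence space ℓ^p, and let x ∈ ℓ^p. Then the following are equivalent: (i) x_n converges weakly to x, i.e. Σ_{k≥1} x_n(k)·y(k) → Σ_{k≥1} x(k)·y(k) as n → ∞ for every y ∈ ℓ^q; (ii) d_p(x_n, x) → 0 as n → ∞. -/
open Filter Topology Set
open scoped ENNReal ENat Classical

noncomputable section

lemma summable_of_tsum_ofReal_lt_top {f : ℕ → ℝ} (hf : ∀ k, 0 ≤ f k)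
    (h : ∑' k, ENNReal.ofReal (f k) < ⊤) : Summable f := by
  simpa [ENNReal.toReal_ofReal (hf _)] using ENNReal.summable_toReal h.ne

lemma abs_sub_rpow_le {p : ℝ} (hp : 0 ≤ p) (a b : ℝ) :
    |a - b| ^ p ≤ 2 ^ p * (|a| ^ p + |b| ^ p) := by
  have h : |a - b| ≤ 2 * max |a| |b| := by
    linarith [abs_sub a b, le_max_left |a| |b|, le_max_right |a| |b|]
  calc |a - b| ^ p ≤ (2 * max |a| |b|) ^ p := Real.rpow_le_rpow (abs_nonneg _) h hp
    _ = 2 ^ p * max |a| |b| ^ p := Real.mul_rpow (by norm_num) (by positivity)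
    _ ≤ _ := by
      have ha : 0 ≤ |a| ^ p := by positivity
      have hb : 0 ≤ |b| ^ p := by positivity
      gcongr
      rcases max_choice |a| |b| with h | h <;> rw [h] <;> linarith

lemma tendsto_abs_rpow_zero_iff {p : ℝ} (hp : 0 < p) (u : ℕ → ℝ) :
    Tendsto (fun n => |u n| ^ p) atTop (𝓝 0) ↔ Tendsto u atTop (𝓝 0) := by
  refine ⟨fun h => ?_, fun h => ?_⟩
  · have := h.rpow_const (p := p⁻¹) (Or.inr (by positivity))
    rw [Real.zero_rpow (by positivity)] at this
    simp_rw [Real.rpow_rpow_inv (abs_nonneg _) hp.ne'] at this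
    exact (tendsto_zero_iff_abs_tendsto_zero u).2 this
  · have := ((tendsto_zero_iff_abs_tendsto_zero u).1 h).rpow_const (p := p) (Or.inr hp.le)
    rwa [Real.zero_rpow hp.ne'] at this

/-- For differences bounded coordinatewise, convergence for `dLp` is coordinatewise convergence. -/
lemma tendsto_dLp_zero_iff {p K : ℝ} (hp : 0 < p) {x : ℕ → ℝ} {xs : ℕ → ℕ → ℝ}
    (hK : ∀ n k, |xs n k - x k| ^ p ≤ K) :
    Tendsto (fun n => dLp p (xs n) x) atTop (𝓝 0) ↔
      ∀ k, Tendsto (fun n => xs n k - x k) atTop (𝓝 0) := by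
  have hgeom : Summable fun k : ℕ => (4 : ℝ)⁻¹ ^ (k + 1) * K :=
    ((summable_nat_add_iff 1).2
      (summable_geometric_of_lt_one (r := (4 : ℝ)⁻¹) (by norm_num) (by norm_num))).mul_right K
  have hnonneg : ∀ n k, 0 ≤ (4 : ℝ)⁻¹ ^ (k + 1) * |xs n k - x k| ^ p :=
    fun n k => by positivity
  have hle : ∀ n k, (4 : ℝ)⁻¹ ^ (k + 1) * |xs n k - x k| ^ p ≤ (4 : ℝ)⁻¹ ^ (k + 1) * K :=
    fun n k => mul_le_mul_of_nonneg_left (hK n k) (by positivity)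
  have hsum : ∀ n, Summable fun k => (4 : ℝ)⁻¹ ^ (k + 1) * |xs n k - x k| ^ p :=
    fun n => hgeom.of_nonneg_of_le (hnonneg n) (hle n)
  refine ⟨fun h k => ?_, fun h => ?_⟩
  · have hS : Tendsto (fun n => ∑' k, (4 : ℝ)⁻¹ ^ (k + 1) * |xs n k - x k| ^ p) atTop (𝓝 0) := by
      have := h.rpow_const (p := p) (Or.inr hp.le)
      rw [Real.zero_rpow hp.ne'] at this
      refine this.congr fun n => ?_
      rw [dLp, one_div, Real.rpow_inv_rpow (tsum_nonneg (hnonneg n)) hp.ne']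
    have hS' := hS.const_mul ((4 : ℝ) ^ (k + 1))
    rw [mul_zero] at hS'
    refine (tendsto_abs_rpow_zero_iff hp _).1 (squeeze_zero (fun n => by positivity) ?_ hS')
    intro n
    have := mul_le_mul_of_nonneg_left ((hsum n).le_tsum k fun j _ => hnonneg n j)
      (by positivity : (0 : ℝ) ≤ 4 ^ (k + 1))
    rwa [← mul_assoc, ← mul_pow, mul_inv_cancel₀ (by norm_num), one_pow, one_mul] at this
  · have hS : Tendsto (fun n => ∑' k, (4 : ℝ)⁻¹ ^ (k + 1) * |xs n k - x k| ^ p) atTop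
        (𝓝 (∑' _ : ℕ, (0 : ℝ))) := by
      refine tendsto_tsum_of_dominated_convergence hgeom (fun k => ?_)
        (Eventually.of_forall fun n k => ?_)
      · simpa using ((tendsto_abs_rpow_zero_iff hp _).2 (h k)).const_mul ((4 : ℝ)⁻¹ ^ (k + 1))
      · rw [Real.norm_of_nonneg (hnonneg n k)]
        exact hle n k
    rw [tsum_zero] at hS
    have := hS.rpow_const (p := 1 / p) (Or.inr (by positivity))
    rwa [Real.zero_rpow (by positivity)] at this

/-- A sequence bounded in `ℓ^p` which tends to zero coordinatewise tends to zero when paired with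
any element of `ℓ^q`. -/
lemma tendsto_tsum_abs_mul_zero {p q K : ℝ} (hpq : p.HolderConjugate q) {z : ℕ → ℕ → ℝ}
    {y : ℕ → ℝ} (hz : ∀ n, Summable fun k => |z n k| ^ p) (hK : ∀ n, ∑' k, |z n k| ^ p ≤ K)
    (hy : Summable fun k => |y k| ^ q) (hz0 : ∀ k, Tendsto (fun n => z n k) atTop (𝓝 0)) :
    Tendsto (fun n => ∑' k, |z n k * y k|) atTop (𝓝 0) := by
  have hp := hpq.pos
  have hK0 : 0 ≤ K := (tsum_nonneg fun k => by positivity).trans (hK 0)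
  have hzy : ∀ n, Summable fun k => |z n k * y k| := fun n => by
    simpa only [abs_mul] using Real.summable_mul_of_Lp_Lq_of_nonneg hpq
      (fun k => abs_nonneg (z n k)) (fun k => abs_nonneg (y k)) (hz n) hy
  rw [Metric.tendsto_atTop]
  intro ε hε
  obtain ⟨c, hc, hcK⟩ : ∃ c : ℝ, 0 < c ∧ c ^ p * K < ε / 2 := by
    refine ⟨(ε / (2 * (K + 1))) ^ p⁻¹, by positivity, ?_⟩
    rw [Real.rpow_inv_rpow (by positivity) hp.ne', div_mul_eq_mul_div,
      div_lt_div_iff₀ (by positivity) (by positivity)]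
    nlinarith
  have young : ∀ n k, |z n k * y k| - c ^ p * |z n k| ^ p ≤ c⁻¹ ^ q * |y k| ^ q := fun n k => by
    have h := Real.young_inequality_of_nonneg (a := c * |z n k|) (b := c⁻¹ * |y k|)
      (by positivity) (by positivity) hpq
    have h1 := div_le_self (by positivity : 0 ≤ (c * |z n k|) ^ p) hpq.lt.le
    have h2 := div_le_self (by positivity : 0 ≤ (c⁻¹ * |y k|) ^ q) hpq.symm.lt.le
    rw [Real.mul_rpow hc.le (abs_nonneg _)] at h h1
    rw [Real.mul_rpow (by positivity) (abs_nonneg _)] at h h2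
    have h3 : c * |z n k| * (c⁻¹ * |y k|) = |z n k * y k| := by
      rw [abs_mul]; field_simp
    linarith
  have hg_nonneg : ∀ n k, 0 ≤ max (|z n k * y k| - c ^ p * |z n k| ^ p) 0 :=
    fun n k => le_max_right _ _
  have hg_le : ∀ n k, max (|z n k * y k| - c ^ p * |z n k| ^ p) 0 ≤ c⁻¹ ^ q * |y k| ^ q :=
    fun n k => max_le (young n k) (by positivity)
  have hbound := hy.mul_left (c⁻¹ ^ q)
  have hg : Tendsto (fun n => ∑' k, max (|z n k * y k| - c ^ p * |z n k| ^ p) 0) atTop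
      (𝓝 (∑' _ : ℕ, (0 : ℝ))) := by
    refine tendsto_tsum_of_dominated_convergence hbound (fun k => ?_)
      (Eventually.of_forall fun n k => ?_)
    · have h1 := ((hz0 k).mul_const (y k)).abs
      have h2 := ((tendsto_abs_rpow_zero_iff hp _).2 (hz0 k)).const_mul (c ^ p)
      simpa using (h1.sub h2).max (tendsto_const_nhds (x := (0 : ℝ)))
    · rw [Real.norm_of_nonneg (hg_nonneg n k)]
      exact hg_le n k
  rw [tsum_zero, Metric.tendsto_atTop] at hg
  obtain ⟨N, hN⟩ := hg (ε / 2) (half_pos hε)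
  refine ⟨N, fun n hn => ?_⟩
  have hgn := hN n hn
  rw [Real.dist_0_eq_abs] at hgn ⊢
  rw [abs_of_nonneg (tsum_nonneg fun k => abs_nonneg _)]
  have hgs := hbound.of_nonneg_of_le (hg_nonneg n) (hg_le n)
  have hle : ∑' k, |z n k * y k| ≤
      ∑' k, (max (|z n k * y k| - c ^ p * |z n k| ^ p) 0 + c ^ p * |z n k| ^ p) :=
    (hzy n).tsum_le_tsum
      (fun k => by linarith [le_max_left (|z n k * y k| - c ^ p * |z n k| ^ p) 0])
      (hgs.add ((hz n).mul_left _))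
  rw [hgs.tsum_add ((hz n).mul_left _), tsum_mul_left] at hle
  have := mul_le_mul_of_nonneg_left (hK n) (by positivity : 0 ≤ c ^ p)
  linarith [le_abs_self (∑' k, max (|z n k * y k| - c ^ p * |z n k| ^ p) 0)]

/-- for `1 < p < ∞` with conjugate exponent `q`, a bounded sequence
`(x_n)` in `ℓ^p` converges weakly to `x ∈ ℓ^p` if and only if `d_p(x_n, x) → 0`. -/
theorem weak_convergence_iff_dLp (p q : ℝ) (hp : 1 < p) (hpq : 1 / p + 1 / q = 1)
    (x : ℕ → ℝ) (xs : ℕ → ℕ → ℝ)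
    (hx : ∑' k : ℕ, ENNReal.ofReal (|x k| ^ p) < ⊤)
    (C : ℝ) (hbd : ∀ n : ℕ, ∑' k : ℕ, ENNReal.ofReal (|xs n k| ^ p) ≤ ENNReal.ofReal C) :
    (∀ y : ℕ → ℝ, (∑' k : ℕ, ENNReal.ofReal (|y k| ^ q) < ⊤) →
        Tendsto (fun n : ℕ => ∑' k : ℕ, xs n k * y k) atTop
          (𝓝 (∑' k : ℕ, x k * y k))) ↔
      Tendsto (fun n : ℕ => dLp p (xs n) x) atTop (𝓝 0) := by
  have hp0 : 0 < p := by linarith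
  have hconj : p.HolderConjugate q :=
    Real.holderConjugate_iff.2 ⟨hp, by simpa only [one_div] using hpq⟩
  have hxs : Summable fun k => |x k| ^ p :=
    summable_of_tsum_ofReal_lt_top (fun k => by positivity) hx
  have hxss : ∀ n, Summable fun k => |xs n k| ^ p := fun n =>
    summable_of_tsum_ofReal_lt_top (fun k => by positivity)
      ((hbd n).trans_lt ENNReal.ofReal_lt_top)
  have hxsC : ∀ n, ∑' k, |xs n k| ^ p ≤ max C 0 := fun n => by
    have h := hbd n
    rw [← ENNReal.ofReal_tsum_of_nonneg (fun k => by positivity) (hxss n),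
      ENNReal.ofReal_le_ofReal_iff'] at h
    exact le_max_iff.2 h
  set K := 2 ^ p * (max C 0 + ∑' k, |x k| ^ p)
  have hmaj : ∀ n, Summable fun k => 2 ^ p * (|xs n k| ^ p + |x k| ^ p) :=
    fun n => ((hxss n).add hxs).mul_left _
  have hz : ∀ n, Summable fun k => |xs n k - x k| ^ p := fun n =>
    (hmaj n).of_nonneg_of_le (fun k => by positivity) fun k => abs_sub_rpow_le hp0.le _ _
  have hzK : ∀ n, ∑' k, |xs n k - x k| ^ p ≤ K := fun n => by
    refine ((hz n).tsum_le_tsum (fun k => abs_sub_rpow_le hp0.le _ _) (hmaj n)).trans ?_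
    rw [tsum_mul_left, (hxss n).tsum_add hxs]
    exact mul_le_mul_of_nonneg_left (by linarith [hxsC n]) (by positivity)
  rw [tendsto_dLp_zero_iff hp0 fun n k =>
    ((hz n).le_tsum k fun j _ => by positivity).trans (hzK n)]
  refine ⟨fun h k => ?_, fun h y hy => ?_⟩
  · have hsingle : ∀ u : ℕ → ℝ, ∑' j, u j * (Pi.single k 1 : ℕ → ℝ) j = u k := fun u => by
      rw [tsum_eq_single k fun j hj => by simp [hj]]
      simp
    have hfin : ∑' j, ENNReal.ofReal (|(Pi.single k 1 : ℕ → ℝ) j| ^ q) < ⊤ := by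
      rw [tsum_eq_single k fun j hj => by simp [hj, Real.zero_rpow hconj.symm.ne_zero]]
      exact ENNReal.ofReal_lt_top
    have := h (Pi.single k 1) hfin
    simp_rw [hsingle] at this
    exact tendsto_sub_nhds_zero_iff.2 this
  · have hys : Summable fun k => |y k| ^ q :=
      summable_of_tsum_ofReal_lt_top (fun k => by positivity) hy
    have hmul : ∀ u : ℕ → ℝ, (Summable fun k => |u k| ^ p) → Summable fun k => |u k * y k| :=
      fun u hu => by
        simpa only [abs_mul] using Real.summable_mul_of_Lp_Lq_of_nonneg hconj
          (fun k => abs_nonneg (u k)) (fun k => abs_nonneg (y k)) hu hys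
    refine tendsto_sub_nhds_zero_iff.1 (squeeze_zero_norm (fun n => ?_)
      (tendsto_tsum_abs_mul_zero hconj hz hzK hys h))
    rw [← (hmul _ (hxss n)).of_abs.tsum_sub (hmul _ hxs).of_abs]
    simp_rw [← sub_mul]
    exact norm_tsum_le_tsum_norm (hmul _ (hz n))

end
end
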